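/- Let S⁰ be a quasi-ideal adequate transversal of an abundant semigroup S and let T = {(x,a) ∈ L × R : x̄ = ā} with multiplication (x,a)(y,b) = (e_x a y, a y f_b). Then the set of idempotents of T is E(T) = {(e_y ȳ, ȳ f_y) : y ∈ E(S)}; moreover, if (x,a) ∈ E(T) then x and a are regular elements of S. -/

import Mathlib

/-!
Common framework: "relative" semigroup-theoretic notions.  All notions are taken
relative to a carrier set `U` inside an ambient type, together with an explicit
binary operation `mul` (only the values of `mul` on `U` are relevant).  For an
honest semigroup `S` one takes `U = Set.univ` and `mul = mulOf S`.

* `RStarOn mul U a b` : the relation `a ℛ* b` computed in `U` with an identity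
  adjoined (the two clauses correspond to multipliers from `U` and to the
  adjoined identity).
* `LStarOn`, `GreenLOn`, `GreenROn` : dual / Green's relations.
* `AbundantOn`, `AdequateOn`, `LeftAdequateOn`, `RightAdequateOn`.
* `AdequateTransversalOn mul U S0` : `S0` is an adequate `*`-subsemigroup of `U`
  which is an adequate transversal, with the data `bar x = x̄`, `e x = e_x`,
  `f x = f_x`, and `plus s = s⁺`, `star s = s⋆` for `s ∈ S0`.
* `InverseTransversalOn mul U S0` : `S0` is an inverse transversal of the
  regular semigroup `U`, with `o x = x⁰` the unique inverse of `x` in `S0`.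
-/

namespace Paper

universe u

variable {α : Type*} {β : Type*} {γ : Type*}

def mulOf (α : Type*) [Mul α] : α → α → α := fun a b => a * b

/-- `x` is an idempotent for the operation `mul`. -/
def Idem (mul : α → α → α) (x : α) : Prop := mul x x = x

/-- The relation `ℛ*` on `U` (with an identity adjoined to `U`). -/
def RStarOn (mul : α → α → α) (U : Set α) (a b : α) : Prop :=
  (∀ x ∈ U, ∀ y ∈ U, (mul x a = mul y a ↔ mul x b = mul y b)) ∧
  (∀ x ∈ U, (mul x a = a ↔ mul x b = b))

/-- The relation `ℒ*` on `U` (with an identity adjoined to `U`). -/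
def LStarOn (mul : α → α → α) (U : Set α) (a b : α) : Prop :=
  (∀ x ∈ U, ∀ y ∈ U, (mul a x = mul a y ↔ mul b x = mul b y)) ∧
  (∀ x ∈ U, (mul a x = a ↔ mul b x = b))

/-- Green's relation `ℒ` on `U`: `U¹ a = U¹ b`. -/
def GreenLOn (mul : α → α → α) (U : Set α) (a b : α) : Prop :=
  (a = b ∨ ∃ u ∈ U, mul u b = a) ∧ (b = a ∨ ∃ v ∈ U, mul v a = b)

/-- Green's relation `ℛ` on `U`: `a U¹ = b U¹`. -/
def GreenROn (mul : α → α → α) (U : Set α) (a b : α) : Prop :=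
  (a = b ∨ ∃ u ∈ U, mul b u = a) ∧ (b = a ∨ ∃ v ∈ U, mul a v = b)

/-- `U` is closed under `mul`. -/
def ClosedOn (mul : α → α → α) (U : Set α) : Prop :=
  ∀ a ∈ U, ∀ b ∈ U, mul a b ∈ U

/-- `U` with the operation `mul` is a semigroup. -/
def SemigroupOn (mul : α → α → α) (U : Set α) : Prop :=
  ClosedOn mul U ∧ ∀ a ∈ U, ∀ b ∈ U, ∀ c ∈ U, mul (mul a b) c = mul a (mul b c)

/-- Every `ℛ*`-class and every `ℒ*`-class of `U` contains an idempotent. -/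
def AbundantOn (mul : α → α → α) (U : Set α) : Prop :=
  ∀ a ∈ U, (∃ e ∈ U, Idem mul e ∧ RStarOn mul U a e) ∧
           (∃ f ∈ U, Idem mul f ∧ LStarOn mul U a f)

/-- Abundant with commuting idempotents. -/
def AdequateOn (mul : α → α → α) (U : Set α) : Prop :=
  AbundantOn mul U ∧
    ∀ u ∈ U, ∀ v ∈ U, Idem mul u → Idem mul v → mul u v = mul v u

/-- Abundant, and every `ℛ*`-class contains a unique idempotent. -/
def LeftAdequateOn (mul : α → α → α) (U : Set α) : Prop :=
  AbundantOn mul U ∧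
    ∀ u ∈ U, ∀ v ∈ U, Idem mul u → Idem mul v → RStarOn mul U u v → u = v

/-- Abundant, and every `ℒ*`-class contains a unique idempotent. -/
def RightAdequateOn (mul : α → α → α) (U : Set α) : Prop :=
  AbundantOn mul U ∧
    ∀ u ∈ U, ∀ v ∈ U, Idem mul u → Idem mul v → LStarOn mul U u v → u = v

/-- `S0` is a quasi-ideal of `U` : `S0 U S0 ⊆ S0`. -/
def QuasiIdealOn (mul : α → α → α) (U S0 : Set α) : Prop :=
  ∀ s ∈ S0, ∀ x ∈ U, ∀ t ∈ S0, mul (mul s x) t ∈ S0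

/-- Every element of `U` has an inverse in `U`. -/
def RegularOn (mul : α → α → α) (U : Set α) : Prop :=
  ∀ x ∈ U, ∃ u ∈ U, mul (mul x u) x = x ∧ mul (mul u x) u = u

/-- Regular with commuting idempotents, i.e. an inverse semigroup. -/
def InverseSgpOn (mul : α → α → α) (U : Set α) : Prop :=
  RegularOn mul U ∧
    ∀ u ∈ U, ∀ v ∈ U, Idem mul u → Idem mul v → mul u v = mul v u

/-- Regular, and every Green `ℛ`-class contains a unique idempotent. -/
def LeftInverseSgpOn (mul : α → α → α) (U : Set α) : Prop :=
  RegularOn mul U ∧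
    ∀ u ∈ U, ∀ v ∈ U, Idem mul u → Idem mul v → GreenROn mul U u v → u = v

/-- Regular, and every Green `ℒ`-class contains a unique idempotent. -/
def RightInverseSgpOn (mul : α → α → α) (U : Set α) : Prop :=
  RegularOn mul U ∧
    ∀ u ∈ U, ∀ v ∈ U, Idem mul u → Idem mul v → GreenLOn mul U u v → u = v

/-- An isomorphism from `(A, mulA)` onto `(B, mulB)`. -/
def IsoOn (mulA : α → α → α) (mulB : β → β → β) (A : Set α) (B : Set β) : Prop :=
  ∃ θ : α → β, Set.BijOn θ A B ∧ ∀ a ∈ A, ∀ b ∈ A, θ (mulA a b) = mulB (θ a) (θ b)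

/-- `S0` is an adequate transversal of the abundant semigroup `U`.  `S0` is an
adequate `*`-subsemigroup of `U` (witnessed by `plus`/`star`, the canonical
idempotents `a⁺ ℛ* a`, `a⋆ ℒ* a` of elements of `S0`, the `ℛ*`/`ℒ*` relations
being those of the big semigroup `U`, which gives the `*`-subsemigroup property),
and every `x ∈ U` factors uniquely as `x = e_x x̄ f_x` with `x̄ ∈ S0`,
`e_x, f_x` idempotents of `U`, `e_x ℒ x̄⁺` and `f_x ℛ x̄⋆`. -/
structure AdequateTransversalOn (mul : α → α → α) (U S0 : Set α) where
  sub : S0 ⊆ U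
  mul_mem : ∀ a ∈ S0, ∀ b ∈ S0, mul a b ∈ S0
  bar : α → α
  e : α → α
  f : α → α
  plus : α → α
  star : α → α
  plus_mem : ∀ a ∈ S0, plus a ∈ S0
  plus_idem : ∀ a ∈ S0, Idem mul (plus a)
  plus_rstar : ∀ a ∈ S0, RStarOn mul U a (plus a)
  star_mem : ∀ a ∈ S0, star a ∈ S0
  star_idem : ∀ a ∈ S0, Idem mul (star a)
  star_lstar : ∀ a ∈ S0, LStarOn mul U a (star a)
  idem_comm : ∀ u ∈ S0, ∀ v ∈ S0, Idem mul u → Idem mul v → mul u v = mul v u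
  bar_mem : ∀ x ∈ U, bar x ∈ S0
  e_mem : ∀ x ∈ U, e x ∈ U
  f_mem : ∀ x ∈ U, f x ∈ U
  e_idem : ∀ x ∈ U, Idem mul (e x)
  f_idem : ∀ x ∈ U, Idem mul (f x)
  decomp : ∀ x ∈ U, x = mul (mul (e x) (bar x)) (f x)
  e_greenL : ∀ x ∈ U, GreenLOn mul U (e x) (plus (bar x))
  f_greenR : ∀ x ∈ U, GreenROn mul U (f x) (star (bar x))
  unique : ∀ x ∈ U, ∀ s ∈ S0, ∀ e' ∈ U, ∀ f' ∈ U, Idem mul e' → Idem mul f' →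
      x = mul (mul e' s) f' → GreenLOn mul U e' (plus s) → GreenROn mul U f' (star s) →
      s = bar x ∧ e' = e x ∧ f' = f x

namespace AdequateTransversalOn

variable {mul : α → α → α} {U S0 : Set α}

/-- `R = {x ∈ U : e_x = e_{x̄}}`. -/
def Rset (T : AdequateTransversalOn mul U S0) : Set α :=
  {x | x ∈ U ∧ T.e x = T.e (T.bar x)}

/-- `L = {x ∈ U : f_x = f_{x̄}}`. -/
def Lset (T : AdequateTransversalOn mul U S0) : Set α :=
  {x | x ∈ U ∧ T.f x = T.f (T.bar x)}

/-- `I = {e_x : x ∈ U}`. -/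
def Iset (T : AdequateTransversalOn mul U S0) : Set α :=
  {y | ∃ x ∈ U, T.e x = y}

/-- `Λ = {f_x : x ∈ U}`. -/
def LamSet (T : AdequateTransversalOn mul U S0) : Set α :=
  {y | ∃ x ∈ U, T.f x = y}

/-- The transversal is multiplicative: `Λ I ⊆ E⁰`. -/
def IsMultiplicative (T : AdequateTransversalOn mul U S0) : Prop :=
  ∀ l ∈ T.LamSet, ∀ i ∈ T.Iset, mul l i ∈ S0 ∧ Idem mul (mul l i)

end AdequateTransversalOn

/-- The spined product set `T = L |×| R ⊆ S × S` attached to an adequate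
transversal of `S` (ambient carrier `U`). -/
def spSet {mul : α → α → α} {U S0 : Set α}
    (T : AdequateTransversalOn mul U S0) : Set (α × α) :=
  {p | p.1 ∈ T.Lset ∧ p.2 ∈ T.Rset ∧ T.bar p.1 = T.bar p.2}

/-- The multiplication `(x,a)(y,b) = (e_x(ay), (ay) f_b)` on the spined product. -/
def spMul {mul : α → α → α} {U S0 : Set α}
    (T : AdequateTransversalOn mul U S0) : α × α → α × α → α × α :=
  fun p q => (mul (T.e p.1) (mul p.2 q.1), mul (mul p.2 q.1) (T.f q.2))

/-- The map `φ : S → T`, `x ↦ (e_x x̄, x̄ f_x)`. -/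
def phiMap {mul : α → α → α} {U S0 : Set α}
    (T : AdequateTransversalOn mul U S0) : α → α × α :=
  fun x => (mul (T.e x) (T.bar x), mul (T.bar x) (T.f x))

/-- `T⁰ = {(s,s) : s ∈ S0}`. -/
def diagSet (S0 : Set α) : Set (α × α) := {p | ∃ s ∈ S0, p = (s, s)}

/-- Abstract spined product `L |×| R` over a common transversal `S⁰` (a type `γ`
embedded into `L` and `R` by `jL`, `jR`). -/
def absTset {mulL : α → α → α} {mulR : β → β → β} {jL : γ → α} {jR : γ → β}
    (TL : AdequateTransversalOn mulL Set.univ (Set.range jL))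
    (TR : AdequateTransversalOn mulR Set.univ (Set.range jR)) : Set (α × β) :=
  {p | ∃ s : γ, jL s = TL.bar p.1 ∧ jR s = TR.bar p.2}

/-- The multiplication `(x,a)(y,b) = (e_x(a∗y), (a∗y) f_b)`. -/
def absMul {mulL : α → α → α} {mulR : β → β → β} {jL : γ → α} {jR : γ → β}
    (TL : AdequateTransversalOn mulL Set.univ (Set.range jL))
    (TR : AdequateTransversalOn mulR Set.univ (Set.range jR))
    (st : β → α → γ) : α × β → α × β → α × β :=
  fun p q => (mulL (TL.e p.1) (jL (st p.2 q.1)), mulR (jR (st p.2 q.1)) (TR.f q.2))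

/-- `T⁰ = {(s,s) : s ∈ S⁰}` inside `L × R`, where `s` is viewed in `L` and in `R`. -/
def absT0 (jL : γ → α) (jR : γ → β) : Set (α × β) :=
  {p | ∃ s : γ, p = (jL s, jR s)}

/-- `S0` is an inverse transversal of the regular semigroup `U`: an inverse
subsemigroup meeting the set of inverses of each `x ∈ U` in exactly one
element `o x = x⁰`. -/
structure InverseTransversalOn (mul : α → α → α) (U S0 : Set α) where
  sub : S0 ⊆ U
  mul_mem : ∀ a ∈ S0, ∀ b ∈ S0, mul a b ∈ S0
  o : α → α
  o_mem : ∀ x ∈ U, o x ∈ S0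
  o_inv1 : ∀ x ∈ U, mul (mul x (o x)) x = x
  o_inv2 : ∀ x ∈ U, mul (mul (o x) x) (o x) = o x
  o_unique : ∀ x ∈ U, ∀ u ∈ S0, mul (mul x u) x = x → mul (mul u x) u = u → u = o x
  idem_comm : ∀ u ∈ S0, ∀ v ∈ S0, Idem mul u → Idem mul v → mul u v = mul v u

namespace InverseTransversalOn

variable {mul : α → α → α} {U S0 : Set α}

/-- `L = {x ∈ U : x⁰x ∈ E⁰}`. -/
def LsetI (T : InverseTransversalOn mul U S0) : Set α :=
  {x | x ∈ U ∧ mul (T.o x) x ∈ S0 ∧ Idem mul (mul (T.o x) x)}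

/-- `R = {x ∈ U : xx⁰ ∈ E⁰}`. -/
def RsetI (T : InverseTransversalOn mul U S0) : Set α :=
  {x | x ∈ U ∧ mul x (T.o x) ∈ S0 ∧ Idem mul (mul x (T.o x))}

end InverseTransversalOn

/-- Spined product set for an inverse transversal: `{(x,a) : x⁰ = a⁰}`. -/
def invSpSet {mul : α → α → α} {U S0 : Set α}
    (T : InverseTransversalOn mul U S0) : Set (α × α) :=
  {p | p.1 ∈ T.LsetI ∧ p.2 ∈ T.RsetI ∧ T.o p.1 = T.o p.2}

/-- The multiplication `(x,a)(y,b) = ((xx⁰)(ay), (ay)(b⁰b))`. -/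
def invSpMul {mul : α → α → α} {U S0 : Set α}
    (T : InverseTransversalOn mul U S0) : α × α → α × α → α × α :=
  fun p q => (mul (mul p.1 (T.o p.1)) (mul p.2 q.1),
              mul (mul p.2 q.1) (mul (T.o q.2) q.2))

/-- Abstract spined product for inverse transversals: `{(x,a) : x⁰ = a⁰}`. -/
def invAbsTset {mulL : α → α → α} {mulR : β → β → β} {jL : γ → α} {jR : γ → β}
    (TL : InverseTransversalOn mulL Set.univ (Set.range jL))
    (TR : InverseTransversalOn mulR Set.univ (Set.range jR)) : Set (α × β) :=
  {p | ∃ s : γ, jL s = TL.o p.1 ∧ jR s = TR.o p.2}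

/-- The multiplication `(x,a)(y,b) = ((xx⁰)(a∗y), (a∗y)(b⁰b))`. -/
def invAbsMul {mulL : α → α → α} {mulR : β → β → β} {jL : γ → α} {jR : γ → β}
    (TL : InverseTransversalOn mulL Set.univ (Set.range jL))
    (TR : InverseTransversalOn mulR Set.univ (Set.range jR))
    (st : β → α → γ) : α × β → α × β → α × β :=
  fun p q => (mulL (mulL p.1 (TL.o p.1)) (jL (st p.2 q.1)),
              mulR (jR (st p.2 q.1)) (mulR (TR.o q.2) q.2))

/-- The multiplication `(e,x)(g,w) = (e(aa⁻¹), a)`, `a = x((x⁻¹x)g)w`, on `I × S⁰`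
(Chen-style construction from a left normal band `I` with semilattice transversal
`E⁰ = E(S⁰)`; `σ` embeds idempotents of the inverse semigroup `γ` into the band
`β`, and `π : β → γ` is the semilattice-transversal map `e ↦ e⁰`). -/
def bandMul (mulB : β → β → β) (mulG : γ → γ → γ) (σ : γ → β) (π : β → γ)
    (inv : γ → γ) (p q : β × γ) : β × γ :=
  let a := mulG (mulG p.2 (π (mulB (σ (mulG (inv p.2) p.2)) q.1))) q.2
  (mulB p.1 (σ (mulG a (inv a))), a)

/-- `T = {(e,x) : e⁰ = xx⁻¹}`. -/
def bandTset (mulG : γ → γ → γ) (π : β → γ) (inv : γ → γ) : Set (β × γ) :=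
  {p | π p.1 = mulG p.2 (inv p.2)}

/-- `T⁰ = {(aa⁻¹, a) : a ∈ S⁰}` (with `aa⁻¹` viewed in the band via `σ`). -/
def bandT0 (mulG : γ → γ → γ) (σ : γ → β) (inv : γ → γ) : Set (β × γ) :=
  {p | ∃ s : γ, p = (σ (mulG s (inv s)), s)}

end Paper

namespace Paper

variable {S : Type*} [Semigroup S]

theorem GreenLOn.mul_left_eq {a b : S} (h : GreenLOn (mulOf S) Set.univ a b)
    (ha : Idem (mulOf S) a) : b * a = b := by
  rcases h.2 with rfl | ⟨v, -, rfl⟩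
  · exact ha
  · have ha' : a * a = a := ha
    simp only [mulOf, mul_assoc, ha']

theorem GreenROn.mul_right_eq {a b : S} (h : GreenROn (mulOf S) Set.univ a b)
    (ha : Idem (mulOf S) a) : a * b = b := by
  rcases h.2 with rfl | ⟨v, -, rfl⟩
  · exact ha
  · have ha' : a * a = a := ha
    simp only [mulOf, ← mul_assoc, ha']

namespace AdequateTransversalOn

variable {S0 : Set S} (T : AdequateTransversalOn (mulOf S) Set.univ S0)

theorem plus_mul {s : S} (hs : s ∈ S0) : T.plus s * s = s :=
  ((T.plus_rstar s hs).2 (T.plus s) trivial).2 (T.plus_idem s hs)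

theorem mul_star {s : S} (hs : s ∈ S0) : s * T.star s = s :=
  ((T.star_lstar s hs).2 (T.star s) trivial).2 (T.star_idem s hs)

theorem greenL_refl (a : S) : GreenLOn (mulOf S) Set.univ a a := ⟨.inl rfl, .inl rfl⟩

theorem greenR_refl (a : S) : GreenROn (mulOf S) Set.univ a a := ⟨.inl rfl, .inl rfl⟩

theorem plus_mul_e (x : S) : T.plus (T.bar x) * T.e x = T.plus (T.bar x) :=
  (T.e_greenL x trivial).mul_left_eq (T.e_idem x trivial)

theorem f_mul_star (x : S) : T.f x * T.star (T.bar x) = T.star (T.bar x) :=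
  (T.f_greenR x trivial).mul_right_eq (T.f_idem x trivial)

/-- The bar, `e` and `f` of a product `e_x s f_z` with `x̄ = z̄ = s`. -/
theorem glue {x z : S} (h : T.bar x = T.bar z) :
    T.bar (T.e x * T.bar x * T.f z) = T.bar x ∧ T.e (T.e x * T.bar x * T.f z) = T.e x ∧
      T.f (T.e x * T.bar x * T.f z) = T.f z := by
  obtain ⟨h₁, h₂, h₃⟩ := T.unique (T.e x * T.bar x * T.f z) trivial (T.bar x)
    (T.bar_mem x trivial) (T.e x) trivial (T.f z) trivial (T.e_idem x trivial)
    (T.f_idem z trivial) rfl (T.e_greenL x trivial) (h ▸ T.f_greenR z trivial)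
  exact ⟨h₁.symm, h₂.symm, h₃.symm⟩

theorem bar_e_f_of_mem {s : S} (hs : s ∈ S0) :
    T.bar s = s ∧ T.e s = T.plus s ∧ T.f s = T.star s := by
  obtain ⟨h₁, h₂, h₃⟩ := T.unique s trivial s hs (T.plus s) trivial (T.star s) trivial
    (T.plus_idem s hs) (T.star_idem s hs)
    (by simp only [mulOf, T.plus_mul hs, T.mul_star hs]) (greenL_refl _) (greenR_refl _)
  exact ⟨h₁.symm, h₂.symm, h₃.symm⟩

theorem phiMap_mem_spSet (y : S) : phiMap T y ∈ spSet T := by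
  have hs := T.bar_mem y trivial
  obtain ⟨hb, he, hf⟩ := T.bar_e_f_of_mem hs
  have hl := T.glue (x := y) (z := T.bar y) hb.symm
  have hr := T.glue (x := T.bar y) (z := y) hb
  rw [hf, mul_assoc, T.mul_star hs] at hl
  rw [hb, he, T.plus_mul hs] at hr
  refine ⟨⟨trivial, ?_⟩, ⟨trivial, ?_⟩, hl.1.trans hr.1.symm⟩
  · change T.f (T.e y * T.bar y) = T.f (T.bar (T.e y * T.bar y))
    rw [hl.1, hl.2.2, hf]
  · change T.e (T.bar y * T.f y) = T.e (T.bar (T.bar y * T.f y))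
    rw [hr.1, hr.2.1, he]

theorem exists_eq_phiMap {p : S × S} (hp : p ∈ spSet T) : ∃ y, p = phiMap T y := by
  obtain ⟨x, a⟩ := p
  obtain ⟨⟨-, hx⟩, ⟨-, ha⟩, hb⟩ := hp
  dsimp only at hx ha hb
  have hs := T.bar_mem x trivial
  obtain ⟨-, he, hf⟩ := T.bar_e_f_of_mem hs
  obtain ⟨g₁, g₂, g₃⟩ := T.glue hb
  refine ⟨T.e x * T.bar x * T.f a, Prod.ext ?_ ?_⟩
  · have := T.decomp x trivial
    simp only [mulOf, hx, hf, mul_assoc, T.mul_star hs] at this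
    simpa only [phiMap, mulOf, g₁, g₂] using this
  · have := T.decomp a trivial
    simp only [mulOf, ha, ← hb, he, T.plus_mul hs] at this
    simpa only [phiMap, mulOf, g₁, g₃] using this

theorem e_phiMap_fst (y : S) : T.e (phiMap T y).1 = T.e y := by
  have hs := T.bar_mem y trivial
  obtain ⟨hb, -, hf⟩ := T.bar_e_f_of_mem hs
  have hl := T.glue (x := y) (z := T.bar y) hb.symm
  rw [hf, mul_assoc, T.mul_star hs] at hl
  exact hl.2.1

theorem f_phiMap_snd (y : S) : T.f (phiMap T y).2 = T.f y := by
  have hs := T.bar_mem y trivial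
  obtain ⟨hb, he, -⟩ := T.bar_e_f_of_mem hs
  have hr := T.glue (x := T.bar y) (z := y) hb
  rw [hb, he, T.plus_mul hs] at hr
  exact hr.2.2

theorem bar_eq_of_e_mul {y t : S} (h : T.e y * (T.bar y * t) = T.e y * T.bar y) :
    T.bar y * t = T.bar y := by
  have hs := T.plus_mul (T.bar_mem y trivial)
  have := congrArg (T.plus (T.bar y) * ·) h
  simpa only [← mul_assoc, T.plus_mul_e, hs] using this

theorem bar_eq_of_mul_f {y t : S} (h : t * T.bar y * T.f y = T.bar y * T.f y) :
    t * T.bar y = T.bar y := by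
  have hs := T.mul_star (T.bar_mem y trivial)
  have := congrArg (· * T.star (T.bar y)) h
  simpa only [mul_assoc, T.f_mul_star, hs] using this

theorem idem_iff (y : S) :
    Idem (mulOf S) y ↔ T.bar y * T.f y * T.e y * T.bar y = T.bar y := by
  have hy : T.e y * T.bar y * T.f y = y := (T.decomp y trivial).symm
  constructor
  · intro h
    have h : y * y = y := h
    have h₁ : T.e y * (T.bar y * T.f y * T.e y * T.bar y * T.f y) =
        T.e y * (T.bar y * T.f y) := by
      calc _ = (T.e y * T.bar y * T.f y) * (T.e y * T.bar y * T.f y) := by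
            simp only [mul_assoc]
        _ = T.e y * T.bar y * T.f y := by rw [hy, h]
        _ = _ := mul_assoc ..
    have h₂ := congrArg (T.plus (T.bar y) * ·) h₁
    simp only [← mul_assoc, T.plus_mul_e, T.plus_mul (T.bar_mem y trivial)] at h₂
    exact T.bar_eq_of_mul_f h₂
  · intro h
    change y * y = y
    calc y * y = T.e y * (T.bar y * T.f y * T.e y * T.bar y) * T.f y := by
          nth_rewrite 1 2 [← hy]
          simp only [mul_assoc]
      _ = y := by rw [h, hy]

theorem idem_phiMap_iff (y : S) :
    Idem (spMul T) (phiMap T y) ↔ T.bar y * T.f y * T.e y * T.bar y = T.bar y := by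
  rw [Idem, Prod.ext_iff]
  simp only [spMul, e_phiMap_fst, f_phiMap_snd]
  simp only [phiMap, mulOf]
  constructor
  · rintro ⟨h, -⟩
    have := T.bar_eq_of_e_mul (t := T.f y * (T.e y * T.bar y))
      (by simpa only [mul_assoc] using h)
    simpa only [mul_assoc] using this
  · intro h
    have h' : T.bar y * T.f y * (T.e y * T.bar y) = T.bar y := by rwa [← mul_assoc]
    rw [h']
    exact ⟨rfl, rfl⟩

end AdequateTransversalOn

end Paper

open Paper in
/-- Let `S⁰` be a quasi-ideal adequate transversal of an abundant
semigroup `S` and `T = L |×| R` with `(x,a)(y,b) = (e_x a y, a y f_b)`.  Then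
`E(T) = {(e_y ȳ, ȳ f_y) : y ∈ E(S)}`, and if `(x,a) ∈ E(T)` then `x` and `a` are
regular elements of `S`. -/
theorem stmt6 {S : Type*} [Semigroup S] (S0 : Set S)
    (hS : AbundantOn (mulOf S) Set.univ)
    (T : AdequateTransversalOn (mulOf S) Set.univ S0)
    (hq : QuasiIdealOn (mulOf S) Set.univ S0) :
    {p | p ∈ spSet T ∧ Idem (spMul T) p} =
      {p : S × S | ∃ y : S, Idem (mulOf S) y ∧ p = phiMap T y} ∧
    ∀ p ∈ spSet T, Idem (spMul T) p →
      (∃ u : S, p.1 * u * p.1 = p.1) ∧ (∃ v : S, p.2 * v * p.2 = p.2) := by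
  have key (y : S) : Idem (spMul T) (phiMap T y) ↔ Idem (mulOf S) y :=
    (T.idem_phiMap_iff y).trans (T.idem_iff y).symm
  refine ⟨Set.ext fun p => ⟨?_, ?_⟩, fun p hp hi => ?_⟩
  · rintro ⟨hp, hi⟩
    obtain ⟨y, rfl⟩ := T.exists_eq_phiMap hp
    exact ⟨y, (key y).1 hi, rfl⟩
  · rintro ⟨y, hy, rfl⟩
    exact ⟨T.phiMap_mem_spSet y, (key y).2 hy⟩
  · obtain ⟨y, rfl⟩ := T.exists_eq_phiMap hp
    have h := (T.idem_phiMap_iff y).1 hi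
    refine ⟨⟨T.f y, ?_⟩, ⟨T.e y, ?_⟩⟩
    · change T.e y * T.bar y * T.f y * (T.e y * T.bar y) = T.e y * T.bar y
      simpa only [mul_assoc] using congrArg (T.e y * ·) h
    · change T.bar y * T.f y * T.e y * (T.bar y * T.f y) = T.bar y * T.f y
      simpa only [mul_assoc] using congrArg (· * T.f y) h
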